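/- For every cap a ⊂ S^n and every s ∈ S^n, the test function u_a^s satisfies ∫_{S^n} |∇_g u_a^s|²_g dv_g < (2 ∫_{S^n} |∇_{g₀} X_s|^n_{g₀} dv_{g₀})^{2/n}. -/

import Mathlib

open MeasureTheory Metric Real Filter Set
open scoped RealInnerProductSpace ENNReal NNReal Topology Classical

noncomputable section

/-- Ambient Euclidean space `ℝ^{n+1}`. -/
abbrev Eu (n : ℕ) : Type := EuclideanSpace ℝ (Fin (n + 1))

/-- The unit sphere `S^n ⊆ ℝ^{n+1}` as a subset of the ambient space. -/
def sphSet (n : ℕ) : Set (Eu n) := Metric.sphere (0 : Eu n) 1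

/-- The canonical (round) volume measure of `S^n`, viewed as a measure on the
ambient space `ℝ^{n+1}` supported on the unit sphere. -/
def sphMeasure (n : ℕ) : Measure (Eu n) :=
  Measure.map Subtype.val ((volume : Measure (Eu n)).toSphere)

/-- `σ_n`, the volume of the round unit `n`-sphere. -/
def sigmaVol (n : ℕ) : ℝ := (sphMeasure n Set.univ).toReal

/-- The constant `K_n`. -/
def Kconst (n : ℕ) : ℝ :=
  ((n + 1 : ℝ) / n) *
    ((Real.Gamma n * Real.Gamma ((n + 1) / 2)) /
      (Real.Gamma (n + 1 / 2) * Real.Gamma (n / 2))) ^ ((2 : ℝ) / n)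

/-- The linear coordinate function `X_s(x) = s · x`. -/
def Xfun {n : ℕ} (s x : Eu n) : ℝ := ⟪s, x⟫

/-- The tangential gradient on the sphere of (the restriction of) an ambient function:
`∇_{S^n} f (x) = ∇f(x) - ⟨∇f(x), x⟩ x`. -/
def gradS {n : ℕ} (f : Eu n → ℝ) (x : Eu n) : Eu n :=
  gradient f x - ⟪gradient f x, x⟫ • x

/-- A conformal factor `w` represents the metric `g = w² g₀` on `S^n`; it is admissible if it
is smooth and positive on the sphere. -/
def IsConformalFactor (n : ℕ) (w : Eu n → ℝ) : Prop :=
  ContDiff ℝ (⊤ : ℕ∞) w ∧ ∀ x ∈ sphSet n, 0 < w x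

/-- The Riemannian measure `dv_g` of the conformal metric `g = w² g₀`, i.e. `w^n dv_{g₀}`. -/
def confMeasure (n : ℕ) (w : Eu n → ℝ) : Measure (Eu n) :=
  (sphMeasure n).withDensity fun x => ENNReal.ofReal (w x ^ n)

/-- The volume of `(S^n, g)`, `g = w² g₀`. -/
def confVol (n : ℕ) (w : Eu n → ℝ) : ℝ := (confMeasure n w Set.univ).toReal

/-- The Dirichlet energy `∫ |∇_g u|²_g dv_g` of the restriction to `S^n` of `V`,
for `g = w² g₀`: it equals `∫ w^{n-2} |∇_{g₀} V|²_{g₀} dv_{g₀}`. -/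
def dirichlet (n : ℕ) (w : Eu n → ℝ) (V : Eu n → ℝ) : ℝ :=
  ∫ x, w x ^ (n - 2) * ‖gradS V x‖ ^ 2 ∂(sphMeasure n)

/-- `∫ u² dv_g`. -/
def l2sq (n : ℕ) (w : Eu n → ℝ) (V : Eu n → ℝ) : ℝ :=
  ∫ x, (V x) ^ 2 ∂(confMeasure n w)

/-- Mean value zero w.r.t. `dv_g`. -/
def MeanZero (n : ℕ) (w : Eu n → ℝ) (V : Eu n → ℝ) : Prop :=
  ∫ x, V x ∂(confMeasure n w) = 0

/-- The second nonzero eigenvalue `λ₂(S^n, g)` of the Laplace–Beltrami operator of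
`g = w² g₀`, defined via the Courant–Fischer min-max characterization over two-dimensional
spaces of mean-zero test functions (restrictions of smooth ambient functions). -/
def lambda2 (n : ℕ) (w : Eu n → ℝ) : ℝ :=
  sInf { Λ : ℝ | ∃ V W : Eu n → ℝ, ContDiff ℝ (⊤ : ℕ∞) V ∧ ContDiff ℝ (⊤ : ℕ∞) W ∧
    MeanZero n w V ∧ MeanZero n w W ∧
    (∀ a b : ℝ, (∀ x ∈ sphSet n, a * V x + b * W x = 0) → a = 0 ∧ b = 0) ∧
    Λ = sSup { q : ℝ | ∃ a b : ℝ, ¬(a = 0 ∧ b = 0) ∧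
      q = dirichlet n w (fun x => a * V x + b * W x) /
          l2sq n w (fun x => a * V x + b * W x) } }

/-- The conformal transformation `d_ξ` of the closed unit ball. -/
def dMap {n : ℕ} (ξ : Eu n) (x : Eu n) : Eu n :=
  (1 + 2 * ⟪ξ, x⟫ + ‖x‖ ^ 2 * ‖ξ‖ ^ 2)⁻¹ •
    ((1 - ‖ξ‖ ^ 2) • x + (1 + 2 * ⟪ξ, x⟫ + ‖x‖ ^ 2) • ξ)

/-- The reflection `R_p(x) = x - 2(p·x)p`. -/
def Refl {n : ℕ} (p x : Eu n) : Eu n := x - (2 * ⟪p, x⟫) • p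

/-- The spherical cap `a_{r,p} = d_{rp}(a_{0,p})`. -/
def cap (n : ℕ) (r : ℝ) (p : Eu n) : Set (Eu n) :=
  dMap (r • p) '' {x ∈ sphSet n | 0 < ⟪p, x⟫}

/-- The conformal reflection `τ_{a_{r,p}} = d_{rp} ∘ R_p ∘ d_{-rp}`. -/
def tauMap {n : ℕ} (r : ℝ) (p : Eu n) : Eu n → Eu n :=
  dMap (r • p) ∘ Refl p ∘ dMap (-(r • p))

/-- The measure `μ_{a_{r,p}}`, equal to `dv_g + (τ_a)^* dv_g` on `a` and `0` on `a^*`. -/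
def capMeasure (n : ℕ) (w : Eu n → ℝ) (r : ℝ) (p : Eu n) : Measure (Eu n) :=
  (confMeasure n w + Measure.map (tauMap r p) (confMeasure n w)).restrict (cap n r p)

/-- `d_ξ` renormalizes the finite measure `μ`: `∫ X_s ∘ d_ξ dμ = 0` for all `s ∈ S^n`. -/
def Renormalizes {n : ℕ} (ξ : Eu n) (μ : Measure (Eu n)) : Prop :=
  ∀ s ∈ sphSet n, ∫ x, Xfun s (dMap ξ x) ∂μ = 0

/-- The quadratic form `Q(s) = ∫ X_s² dν` of a measure `ν`. -/
def Qform {n : ℕ} (ν : Measure (Eu n)) (s : Eu n) : ℝ := ∫ x, (⟪s, x⟫ : ℝ) ^ 2 ∂ν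

/-- The maximal eigenvalue of the quadratic form `Q`. -/
def maxEig (n : ℕ) (ν : Measure (Eu n)) : ℝ :=
  sSup { q : ℝ | ∃ s : Eu n, ‖s‖ = 1 ∧ q = Qform ν s }

/-- `ν` is simple with (unit) maximal direction `s₀`: the eigenspace of the maximal
eigenvalue of `Q` is the line spanned by `s₀`. -/
def IsMaxDir {n : ℕ} (ν : Measure (Eu n)) (s₀ : Eu n) : Prop :=
  ‖s₀‖ = 1 ∧ ∀ s : Eu n, Qform ν s = maxEig n ν * ‖s‖ ^ 2 ↔ ∃ c : ℝ, s = c • s₀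

/-- `ν` is multiple: the eigenspace of the maximal eigenvalue of `Q` has dimension ≥ 2. -/
def IsMultiple {n : ℕ} (ν : Measure (Eu n)) : Prop :=
  ∃ s t : Eu n, Qform ν s = maxEig n ν * ‖s‖ ^ 2 ∧ Qform ν t = maxEig n ν * ‖t‖ ^ 2 ∧
    LinearIndependent ℝ ![s, t]

/-- The test function `u_a^s` (for `a = a_{r,p}` with renormalization point `ξ`):
`X_s ∘ d_ξ` on `a` and `X_s ∘ d_ξ ∘ τ_a` on `a^*`. -/
def testFun (n : ℕ) (ξ : Eu n) (r : ℝ) (p : Eu n) (s : Eu n) (x : Eu n) : ℝ :=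
  if 0 < ⟪p, dMap (-(r • p)) x⟫ then Xfun s (dMap ξ x) else Xfun s (dMap ξ (tauMap r p x))

/-- The first coordinate vector `e₁ ∈ ℝ^{n+1}`. -/
def e1 (n : ℕ) : Eu n := EuclideanSpace.single 0 1

/-- `φ` maps the unit sphere injectively to itself and its ambient derivative at each point `x` of
the sphere is `c x` times a linear isometry carrying the normal `x` to the normal `φ x`. -/
structure IsConformalOnSphere {n : ℕ} (φ : Eu n → Eu n) (c : Eu n → ℝ) : Prop where
  measurable : Measurable φ
  measurable_factor : Measurable c
  factor_pos : ∀ x ∈ sphSet n, 0 < c x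
  injOn : InjOn φ (sphSet n)
  exists_deriv : ∀ x ∈ sphSet n, ∃ O : Eu n ≃ₗᵢ[ℝ] Eu n, O x = φ x ∧
    HasFDerivAt φ (c x • (O : Eu n →L[ℝ] Eu n)) x

namespace IsConformalOnSphere

variable {n : ℕ} {φ ψ : Eu n → Eu n} {c d : Eu n → ℝ}

lemma norm_map (h : IsConformalOnSphere φ c) {x : Eu n} (hx : ‖x‖ = 1) : ‖φ x‖ = 1 := by
  obtain ⟨O, hO, -⟩ := h.exists_deriv x (by simpa [sphSet] using hx)
  rw [← hO, O.norm_map, hx]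

lemma mapsTo (h : IsConformalOnSphere φ c) : MapsTo φ (sphSet n) (sphSet n) := fun x hx => by
  have := h.norm_map (x := x) (by simpa [sphSet] using hx)
  simpa [sphSet] using this

lemma continuousAt (h : IsConformalOnSphere φ c) {x : Eu n} (hx : x ∈ sphSet n) :
    ContinuousAt φ x := by
  obtain ⟨O, -, hO⟩ := h.exists_deriv x hx
  exact hO.continuousAt

lemma comp (hψ : IsConformalOnSphere ψ d) (hφ : IsConformalOnSphere φ c) :
    IsConformalOnSphere (ψ ∘ φ) (fun x => d (φ x) * c x) where
  measurable := hψ.measurable.comp hφ.measurable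
  measurable_factor := (hψ.measurable_factor.comp hφ.measurable).mul hφ.measurable_factor
  factor_pos x hx := mul_pos (hψ.factor_pos _ (hφ.mapsTo hx)) (hφ.factor_pos x hx)
  injOn := hψ.injOn.comp hφ.injOn hφ.mapsTo
  exists_deriv x hx := by
    obtain ⟨O, hOx, hO⟩ := hφ.exists_deriv x hx
    obtain ⟨P, hPx, hP⟩ := hψ.exists_deriv _ (hφ.mapsTo hx)
    refine ⟨O.trans P, by simp [hOx, hPx], (hP.comp x hO).congr_fderiv ?_⟩
    ext v : 1
    simp [smul_smul, mul_comm]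

/-- Conformal change of the tangential gradient of a linear coordinate. -/
lemma norm_gradS_comp (h : IsConformalOnSphere φ c) (s : Eu n) {x : Eu n} (hx : x ∈ sphSet n) :
    ‖gradS (fun y => Xfun s (φ y)) x‖ = c x * ‖s - ⟪s, φ x⟫ • φ x‖ := by
  obtain ⟨O, hOx, hO⟩ := h.exists_deriv x hx
  have hg : HasGradientAt (fun y => Xfun s (φ y)) (c x • O.symm s) x := by
    rw [hasGradientAt_iff_hasFDerivAt]
    refine ((innerSL ℝ s).hasFDerivAt.comp x hO).congr_fderiv ?_
    ext v : 1
    have : (⟪O.symm s, v⟫ : ℝ) = ⟪s, O v⟫ := by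
      rw [← O.inner_map_map, O.apply_symm_apply]
    simp [this]
  have hs : (⟪O.symm s, x⟫ : ℝ) = ⟪s, φ x⟫ := by
    rw [← O.inner_map_map, O.apply_symm_apply, hOx]
  have : gradS (fun y => Xfun s (φ y)) x = c x • O.symm (s - (⟪s, φ x⟫ : ℝ) • φ x) := by
    rw [gradS, hg.gradient, map_sub, map_smul, ← hOx, O.symm_apply_apply, hOx, inner_smul_left, hs]
    simp [smul_sub, smul_smul]
  rw [this, norm_smul, O.symm.norm_map, Real.norm_of_nonneg (h.factor_pos x hx).le]

end IsConformalOnSphere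

lemma gradS_Xfun {n : ℕ} (s x : Eu n) : gradS (Xfun s) x = s - ⟪s, x⟫ • x := by
  have hg : HasGradientAt (Xfun s) s x := by
    rw [hasGradientAt_iff_hasFDerivAt]
    exact (innerSL ℝ s).hasFDerivAt
  rw [gradS, hg.gradient]

lemma isConformalOnSphere_Refl {n : ℕ} {p : Eu n} (hp : ‖p‖ = 1) :
    IsConformalOnSphere (Refl p) (fun _ => 1) := by
  have hR : Refl p = ((ℝ ∙ p)ᗮ.reflection : Eu n → Eu n) := by
    funext x
    rw [Submodule.reflection_orthogonal_apply, Submodule.reflection_singleton_apply, hp, Refl]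
    simp [two_smul, add_smul, two_mul]
  refine ⟨?_, by fun_prop, by simp, ?_, fun x hx => ⟨(ℝ ∙ p)ᗮ.reflection, by rw [hR], ?_⟩⟩
  · unfold Refl; fun_prop
  · rw [hR]; exact (LinearIsometryEquiv.injective _).injOn
  · rw [hR, one_smul]
    exact ((ℝ ∙ p)ᗮ.reflection : Eu n →L[ℝ] Eu n).hasFDerivAt

lemma norm_add_pos_of_lt {n : ℕ} {ξ x : Eu n} (hξ : ‖ξ‖ < 1) (hx : ‖x‖ = 1) : 0 < ‖x + ξ‖ := by
  have := norm_sub_le (x + ξ) ξ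
  rw [add_sub_cancel_right, hx] at this
  linarith

/-- The conformal factor of `dMap ξ`. -/
def dFactor {n : ℕ} (ξ x : Eu n) : ℝ := (1 - ‖ξ‖ ^ 2) / (1 + 2 * ⟪ξ, x⟫ + ‖x‖ ^ 2 * ‖ξ‖ ^ 2)

lemma norm_add_sq_eq_denom {n : ℕ} {ξ x : Eu n} (hx : ‖x‖ = 1) :
    ‖x + ξ‖ ^ 2 = 1 + 2 * ⟪ξ, x⟫ + ‖x‖ ^ 2 * ‖ξ‖ ^ 2 := by
  rw [norm_add_sq_real, hx, real_inner_comm]; ring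

lemma dMap_of_norm_eq_one {n : ℕ} {ξ x : Eu n} (hξ : ‖ξ‖ < 1) (hx : ‖x‖ = 1) :
    dMap ξ x = ξ + ((1 - ‖ξ‖ ^ 2) / ‖x + ξ‖ ^ 2) • (x + ξ) := by
  have hz := norm_add_sq_eq_denom (ξ := ξ) hx
  have hpos := norm_add_pos_of_lt hξ hx
  rw [dMap, ← hz, hx, show (⟪ξ, x⟫ : ℝ) = (‖x + ξ‖ ^ 2 - 1 - ‖ξ‖ ^ 2) / 2 by rw [hz, hx]; ring]
  match_scalars <;> field_simp
  ring

/-- The isometric part of the derivative of `dMap ξ` at a unit vector `x`. -/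
def dIsom {n : ℕ} (ξ x : Eu n) : Eu n ≃ₗᵢ[ℝ] Eu n :=
  (ℝ ∙ x).reflection.trans (ℝ ∙ (x + ξ)).reflection

lemma dIsom_apply {n : ℕ} {ξ x : Eu n} (hξ : ‖ξ‖ < 1) (hx : ‖x‖ = 1) (v : Eu n) :
    dIsom ξ x v = v - (2 * ⟪x + ξ, v⟫ / ‖x + ξ‖ ^ 2) • (x + ξ) + (2 * ⟪x, v⟫) • dMap ξ x := by
  have hz := norm_add_sq_eq_denom (ξ := ξ) hx
  have hpos := norm_add_pos_of_lt hξ hx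
  rw [dMap_of_norm_eq_one hξ hx]
  simp only [dIsom, LinearIsometryEquiv.trans_apply, Submodule.reflection_singleton_apply]
  set D := ‖x + ξ‖ ^ 2 with hD
  have hDne : D ≠ 0 := by positivity
  have e : (⟪x + ξ, x⟫ : ℝ) = 1 + ⟪ξ, x⟫ := by
    rw [inner_add_left, real_inner_self_eq_norm_sq, hx]; ring
  simp only [inner_sub_right, inner_smul_right, e, hx, RCLike.ofReal_real_eq_id, id, smul_add,
    two_smul ℕ, inner_add_right, ← hD]
  have e2 : (⟪ξ, x⟫ : ℝ) = (D - 1 - ‖ξ‖ ^ 2) / 2 := by rw [hz, hx]; ring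
  rw [e2]
  match_scalars <;> field_simp <;> ring

lemma dIsom_self {n : ℕ} {ξ x : Eu n} (hξ : ‖ξ‖ < 1) (hx : ‖x‖ = 1) :
    dIsom ξ x x = dMap ξ x := by
  have hz := norm_add_sq_eq_denom (ξ := ξ) hx
  have hpos := norm_add_pos_of_lt hξ hx
  rw [dIsom_apply hξ hx, dMap_of_norm_eq_one hξ hx]
  set D := ‖x + ξ‖ ^ 2 with hD
  have hDne : D ≠ 0 := by positivity
  have e : (⟪x + ξ, x⟫ : ℝ) = (D + 1 - ‖ξ‖ ^ 2) / 2 := by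
    rw [inner_add_left, real_inner_self_eq_norm_sq, hz, hx]; ring
  rw [e, real_inner_self_eq_norm_sq, hx]
  match_scalars <;> field_simp <;> ring

lemma hasFDerivAt_dMap {n : ℕ} {ξ x : Eu n} (hξ : ‖ξ‖ < 1) (hx : ‖x‖ = 1) :
    HasFDerivAt (dMap ξ) (dFactor ξ x • (dIsom ξ x : Eu n →L[ℝ] Eu n)) x := by
  have hz := norm_add_sq_eq_denom (ξ := ξ) hx
  have hpos := norm_add_pos_of_lt hξ hx
  have hDne : ‖x + ξ‖ ^ 2 ≠ 0 := by positivity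
  have hin : HasFDerivAt (fun y : Eu n => (⟪ξ, y⟫ : ℝ)) (innerSL ℝ ξ) x :=
    (innerSL ℝ ξ).hasFDerivAt
  have hsq : HasFDerivAt (fun y : Eu n => ‖y‖ ^ 2) (2 • innerSL ℝ x) x := by
    simpa using (hasStrictFDerivAt_norm_sq x).hasFDerivAt
  have hden : HasFDerivAt (fun y : Eu n => 1 + 2 * ⟪ξ, y⟫ + ‖y‖ ^ 2 * ‖ξ‖ ^ 2) _ x :=
    ((hin.const_mul 2).const_add 1).add (hsq.mul_const (‖ξ‖ ^ 2))
  have hnum : HasFDerivAt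
      (fun y : Eu n => (1 - ‖ξ‖ ^ 2) • y + (1 + 2 * ⟪ξ, y⟫ + ‖y‖ ^ 2) • ξ) _ x :=
    ((hasFDerivAt_id x).const_smul (1 - ‖ξ‖ ^ 2)).add
      ((((hin.const_mul 2).const_add 1).add hsq).smul_const ξ)
  have hinv := (hasDerivAt_inv (hz ▸ hDne)).comp_hasFDerivAt x hden
  refine (hinv.smul hnum).congr_fderiv ?_
  ext v : 1
  simp only [_root_.add_apply, _root_.smul_apply,
    ContinuousLinearMap.smulRight_apply, Function.comp_apply, ContinuousLinearMap.id_apply,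
    innerSL_apply_apply, ContinuousLinearEquiv.coe_coe, dFactor]
  rw [LinearIsometryEquiv.coe_toContinuousLinearEquiv, dIsom_apply hξ hx,
    dMap_of_norm_eq_one hξ hx, inner_add_left]
  rw [← hz, hx]
  have e2 : (⟪ξ, x⟫ : ℝ) = (‖x + ξ‖ ^ 2 - 1 - ‖ξ‖ ^ 2) / 2 := by rw [hz, hx]; ring
  rw [e2]
  set D := ‖x + ξ‖ ^ 2
  simp only [smul_eq_mul, nsmul_eq_mul]
  match_scalars <;> field_simp <;> ring

lemma dMap_neg_dMap {n : ℕ} {ξ x : Eu n} (hξ : ‖ξ‖ < 1) (hx : ‖x‖ = 1) :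
    dMap (-ξ) (dMap ξ x) = x := by
  have hpos := norm_add_pos_of_lt hξ hx
  have hy : ‖dMap ξ x‖ = 1 := by rw [← dIsom_self hξ hx, LinearIsometryEquiv.norm_map, hx]
  have hc : 0 < 1 - ‖ξ‖ ^ 2 := by nlinarith [norm_nonneg ξ]
  rw [dMap_of_norm_eq_one (by rwa [norm_neg]) hy, dMap_of_norm_eq_one hξ hx, norm_neg,
    add_neg_cancel_comm, norm_smul, smul_smul,
    Real.norm_of_nonneg (by positivity)]
  rw [show (1 - ‖ξ‖ ^ 2) / ((1 - ‖ξ‖ ^ 2) / ‖x + ξ‖ ^ 2 * ‖x + ξ‖) ^ 2 *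
    ((1 - ‖ξ‖ ^ 2) / ‖x + ξ‖ ^ 2) = 1 by field_simp]
  simp

lemma isConformalOnSphere_dMap {n : ℕ} {ξ : Eu n} (hξ : ‖ξ‖ < 1) :
    IsConformalOnSphere (dMap ξ) (dFactor ξ) where
  measurable := by unfold dMap; fun_prop
  measurable_factor := by unfold dFactor; fun_prop
  factor_pos x hx := by
    have hx : ‖x‖ = 1 := by simpa [sphSet] using hx
    have hpos := norm_add_pos_of_lt hξ hx
    have hc : 0 < 1 - ‖ξ‖ ^ 2 := by nlinarith [norm_nonneg ξ]
    rw [dFactor, ← norm_add_sq_eq_denom hx]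
    positivity
  injOn x hx y hy hxy := by
    rw [← dMap_neg_dMap hξ (x := x) (by simpa [sphSet] using hx), hxy,
      dMap_neg_dMap hξ (by simpa [sphSet] using hy)]
  exists_deriv x hx := by
    have hx : ‖x‖ = 1 := by simpa [sphSet] using hx
    exact ⟨dIsom ξ x, dIsom_self hξ hx, hasFDerivAt_dMap hξ hx⟩

/-- Radial projection to the unit sphere. -/
def radialUnit {n : ℕ} (y : Eu n) : Eu n := ‖y‖⁻¹ • y

lemma norm_radialUnit {n : ℕ} {y : Eu n} (hy : y ≠ 0) : ‖radialUnit y‖ = 1 := by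
  rw [radialUnit, norm_smul, norm_inv, norm_norm, inv_mul_cancel₀ (norm_ne_zero_iff.2 hy)]

lemma norm_smul_radialUnit {n : ℕ} {y : Eu n} (hy : y ≠ 0) : ‖y‖ • radialUnit y = y := by
  rw [radialUnit, smul_inv_smul₀ (norm_ne_zero_iff.2 hy)]

lemma radialUnit_smul {n : ℕ} {x : Eu n} (hx : ‖x‖ = 1) {t : ℝ} (ht : 0 < t) :
    radialUnit (t • x) = x := by
  rw [radialUnit, norm_smul, hx, Real.norm_of_nonneg ht.le, mul_one, inv_smul_smul₀ ht.ne']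

lemma measurable_radialUnit {n : ℕ} : Measurable (radialUnit (n := n)) := by
  unfold radialUnit; fun_prop

lemma sphMeasure_eq_map (n : ℕ) : sphMeasure n =
    (n + 1 : ℝ≥0∞) •
      Measure.map radialUnit ((volume : Measure (Eu n)).restrict (ball 0 1 \ {0})) := by
  ext A hA
  rw [sphMeasure, Measure.map_apply measurable_subtype_coe hA,
    Measure.toSphere_apply' _ (measurable_subtype_coe hA), Measure.smul_apply,
    Measure.map_apply measurable_radialUnit hA,
    Measure.restrict_apply (measurable_radialUnit hA), smul_eq_mul]
  congr 2
  · simp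
  · ext y
    simp only [Set.mem_smul, mem_image, mem_preimage, mem_inter_iff, Set.mem_sdiff, mem_ball,
      dist_zero_right, mem_singleton_iff]
    constructor
    · rintro ⟨t, ⟨ht0, ht1⟩, _, ⟨x, hx, rfl⟩, rfl⟩
      have hx1 : ‖(x : Eu n)‖ = 1 := norm_eq_of_mem_sphere x
      refine ⟨by rwa [radialUnit_smul hx1 ht0], ?_, smul_ne_zero ht0.ne' ?_⟩
      · rwa [norm_smul, hx1, Real.norm_of_nonneg ht0.le, mul_one]
      · rw [← norm_ne_zero_iff, hx1]; exact one_ne_zero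
    · rintro ⟨hyA, hy1, hy0⟩
      exact ⟨‖y‖, ⟨norm_pos_iff.2 hy0, hy1⟩, radialUnit y,
        ⟨⟨radialUnit y, by simp [norm_radialUnit hy0]⟩, hyA, rfl⟩, norm_smul_radialUnit hy0⟩

lemma lintegral_sphMeasure {n : ℕ} {f : Eu n → ℝ≥0∞} (hf : Measurable f) :
    ∫⁻ x, f x ∂(sphMeasure n) =
      (n + 1 : ℝ≥0∞) * ∫⁻ y in ball (0 : Eu n) 1 \ {0}, f (radialUnit y) := by
  rw [sphMeasure_eq_map, lintegral_smul_measure, smul_eq_mul,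
    lintegral_map hf measurable_radialUnit]

lemma ae_sphMeasure_mem (n : ℕ) : ∀ᵐ x ∂(sphMeasure n), x ∈ sphSet n := by
  rw [sphMeasure, ae_map_iff measurable_subtype_coe.aemeasurable
    (by exact (isClosed_sphere (x := (0 : Eu n))).measurableSet)]
  exact Filter.Eventually.of_forall fun x => x.2

instance (n : ℕ) : IsFiniteMeasure (sphMeasure n) := by
  unfold sphMeasure; infer_instance

lemma hasFDerivAt_norm_of_ne_zero {n : ℕ} {y : Eu n} (hy : y ≠ 0) :
    HasFDerivAt (fun y : Eu n => ‖y‖) (innerSL ℝ (radialUnit y)) y := by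
  have hn : ‖y‖ ≠ 0 := norm_ne_zero_iff.2 hy
  have h := (hasStrictFDerivAt_norm_sq y).hasFDerivAt.sqrt (by positivity)
  simp only [Real.sqrt_sq (norm_nonneg _)] at h
  refine h.congr_fderiv ?_
  ext v : 1
  simp [radialUnit]
  field_simp

lemma hasFDerivAt_radialUnit {n : ℕ} {y : Eu n} (hy : y ≠ 0) :
    HasFDerivAt radialUnit (‖y‖⁻¹ • (ContinuousLinearMap.id ℝ (Eu n) -
      (innerSL ℝ (radialUnit y)).smulRight (radialUnit y))) y := by
  have hn : ‖y‖ ≠ 0 := norm_ne_zero_iff.2 hy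
  refine (((hasDerivAt_inv hn).comp_hasFDerivAt y (hasFDerivAt_norm_of_ne_zero hy)).smul
    (hasFDerivAt_id y)).congr_fderiv ?_
  ext v : 1
  have hu : (⟪radialUnit y, v⟫ : ℝ) • radialUnit y = (⟪radialUnit y, v⟫ * ‖y‖⁻¹ : ℝ) • y := by
    rw [mul_smul]; rfl
  simp [hu]
  match_scalars <;> field_simp

/-- The determinant of a map scaling the orthogonal complement of a unit vector by `c`. -/
lemma abs_det_conformal {n : ℕ} (O : Eu n ≃ₗᵢ[ℝ] Eu n) {x : Eu n} (hx : ‖x‖ = 1) {c : ℝ}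
    (hc : 0 < c) (L : Eu n →L[ℝ] Eu n)
    (hL : ∀ v, L v = O (c • v + ((1 - c) * ⟪x, v⟫) • x)) : |L.det| = c ^ n := by
  have hLeq : (L : Eu n →ₗ[ℝ] Eu n) = (O.toLinearIsometry.toLinearMap) ∘ₗ
      (c • LinearMap.transvection (innerSL ℝ x : Eu n →ₗ[ℝ] ℝ) (((1 - c) / c) • x)) := by
    ext1 v
    simp only [ContinuousLinearMap.coe_coe, hL, LinearMap.comp_apply, LinearMap.smul_apply,
      LinearMap.transvection.apply, innerSL_apply_apply, LinearIsometry.coe_toLinearMap,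
      LinearIsometryEquiv.coe_toLinearIsometry, smul_add, smul_smul]
    congr 3
    field_simp
  have hO : |LinearMap.det O.toLinearIsometry.toLinearMap| = 1 := by
    rw [← LinearMap.normDet_eq_abs_det, LinearIsometry.normDet_eq_one]
  rw [ContinuousLinearMap.det, hLeq, LinearMap.det_comp, abs_mul, hO, one_mul, LinearMap.det_smul,
    LinearMap.transvection.det, finrank_euclideanSpace_fin]
  have : 1 + (innerSL ℝ x : Eu n →ₗ[ℝ] ℝ) (((1 - c) / c) • x) = c⁻¹ := by
    simp [hx]
    field_simp
    ring
  rw [this, pow_succ, mul_assoc, mul_inv_cancel₀ hc.ne', mul_one, abs_of_pos (by positivity)]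

namespace IsConformalOnSphere

variable {n : ℕ} {φ : Eu n → Eu n} {c : Eu n → ℝ}

/-- The derivative of the homogeneous extension of degree one. -/
lemma exists_hasFDerivAt_cone (h : IsConformalOnSphere φ c) {y : Eu n} (hy : y ≠ 0) :
    ∃ L : Eu n →L[ℝ] Eu n, HasFDerivAt (fun y => ‖y‖ • φ (radialUnit y)) L y ∧
      |L.det| = c (radialUnit y) ^ n := by
  have hx1 := norm_radialUnit hy
  have hx : radialUnit y ∈ sphSet n := by simpa [sphSet] using hx1
  obtain ⟨O, hOx, hO⟩ := h.exists_deriv _ hx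
  refine ⟨_, (hasFDerivAt_norm_of_ne_zero hy).smul (hO.comp y (hasFDerivAt_radialUnit hy)),
    abs_det_conformal O hx1 (h.factor_pos _ hx) _ fun v => ?_⟩
  have hn : ‖y‖ ≠ 0 := norm_ne_zero_iff.2 hy
  simp only [_root_.add_apply, _root_.smul_apply, _root_.sub_apply, ContinuousLinearMap.comp_apply,
    ContinuousLinearMap.smulRight_apply, innerSL_apply_apply, ContinuousLinearMap.id_apply,
    ContinuousLinearEquiv.coe_coe, LinearIsometryEquiv.coe_toContinuousLinearEquiv, ← hOx,
    map_sub, map_add, map_smul]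
  match_scalars <;> field_simp
  ring

lemma lintegral_comp_le (h : IsConformalOnSphere φ c) {g : Eu n → ℝ≥0∞} (hg : Measurable g) :
    ∫⁻ x, ENNReal.ofReal (c x ^ n) * g (φ x) ∂(sphMeasure n) ≤ ∫⁻ x, g x ∂(sphMeasure n) := by
  have hm := h.measurable
  have hcm := h.measurable_factor
  rw [lintegral_sphMeasure hg, lintegral_sphMeasure (by fun_prop)]
  gcongr (_ * ?_)
  set B : Set (Eu n) := ball 0 1 \ {0} with hB
  have hBm : MeasurableSet B := measurableSet_ball.diff (measurableSet_singleton 0)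
  have hB0 : ∀ y ∈ B, y ≠ 0 := fun y hy => hy.2
  set Φ : Eu n → Eu n := fun y => ‖y‖ • φ (radialUnit y) with hΦ
  have hφ1 : ∀ y ∈ B, ‖φ (radialUnit y)‖ = 1 := fun y hy =>
    h.norm_map (norm_radialUnit (hB0 y hy))
  have hΦn : ∀ y ∈ B, ‖Φ y‖ = ‖y‖ := fun y hy => by
    rw [hΦ]; simp [norm_smul, hφ1 y hy]
  have hΦu : ∀ y ∈ B, radialUnit (Φ y) = φ (radialUnit y) := fun y hy =>
    radialUnit_smul (hφ1 y hy) (norm_pos_iff.2 (hB0 y hy))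
  have hmaps : Φ '' B ⊆ B := by
    rintro _ ⟨y, hy, rfl⟩
    refine ⟨?_, ?_⟩
    · rw [mem_ball_zero_iff, hΦn y hy]; simpa using hy.1
    · rw [mem_singleton_iff, ← norm_eq_zero, hΦn y hy, norm_eq_zero]; exact hB0 y hy
  have hinj : InjOn Φ B := by
    intro y hy z hz hyz
    have hu : radialUnit y = radialUnit z := by
      refine h.injOn ?_ ?_ (by rw [← hΦu y hy, ← hΦu z hz, hyz])
      · simpa [sphSet] using norm_radialUnit (hB0 y hy)
      · simpa [sphSet] using norm_radialUnit (hB0 z hz)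
    rw [← norm_smul_radialUnit (hB0 y hy), ← norm_smul_radialUnit (hB0 z hz), hu, ← hΦn y hy,
      ← hΦn z hz, hyz]
  choose! L hLd hLdet using fun y (hy : y ∈ B) => h.exists_hasFDerivAt_cone (hB0 y hy)
  calc ∫⁻ y in B, ENNReal.ofReal (c (radialUnit y) ^ n) * g (φ (radialUnit y))
      = ∫⁻ y in B, ENNReal.ofReal |(L y).det| * g (radialUnit (Φ y)) :=
        setLIntegral_congr_fun hBm fun y hy => by simp only [hLdet y hy, hΦu y hy]
    _ = ∫⁻ y in Φ '' B, g (radialUnit y) :=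
        (lintegral_image_eq_lintegral_abs_det_fderiv_mul volume hBm
          (fun y hy => (hLd y hy).hasFDerivWithinAt) hinj fun y => g (radialUnit y)).symm
    _ ≤ ∫⁻ y in B, g (radialUnit y) := lintegral_mono_set hmaps

/-- Great subspheres, and hence their preimages under conformal maps, are negligible. -/
lemma ae_inner_ne_zero (h : IsConformalOnSphere φ c) {q : Eu n} (hq : q ≠ 0) :
    ∀ᵐ x ∂(sphMeasure n), (⟪q, φ x⟫ : ℝ) ≠ 0 := by
  have hm := h.measurable
  have hcm := h.measurable_factor
  set A : Set (Eu n) := {y | (⟪q, y⟫ : ℝ) = 0} with hA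
  have hAm : MeasurableSet A := measurableSet_eq_fun (by fun_prop) measurable_const
  have hgm : Measurable (A.indicator (1 : Eu n → ℝ≥0∞)) := measurable_one.indicator hAm
  have hvol : volume A = 0 := by
    have hAeq : A = ((innerSL ℝ q : Eu n →ₗ[ℝ] ℝ).ker : Set (Eu n)) := by
      ext y; simp [hA]
    rw [hAeq]
    refine Measure.addHaar_submodule _ _ fun htop => hq ?_
    have : q ∈ (innerSL ℝ q : Eu n →ₗ[ℝ] ℝ).ker := htop ▸ Submodule.mem_top
    simpa using this
  have h0 : ∫⁻ x, A.indicator (1 : Eu n → ℝ≥0∞) x ∂(sphMeasure n) = 0 := by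
    rw [lintegral_sphMeasure hgm]
    refine mul_eq_zero_of_right _ (le_antisymm ?_ bot_le)
    calc ∫⁻ y in ball (0 : Eu n) 1 \ {0}, A.indicator (1 : Eu n → ℝ≥0∞) (radialUnit y)
        ≤ ∫⁻ y : Eu n, A.indicator 1 y := by
          refine (setLIntegral_mono' (measurableSet_ball.diff (measurableSet_singleton 0))
            fun y hy => ?_).trans (setLIntegral_le_lintegral _ _)
          have hn : ‖y‖ ≠ 0 := norm_ne_zero_iff.2 hy.2
          have : radialUnit y ∈ A ↔ y ∈ A := by simp [hA, radialUnit, inner_smul_right, hn]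
          by_cases hyA : y ∈ A <;> simp [Set.indicator, this, hyA]
      _ = 0 := by rw [lintegral_indicator_one hAm, hvol]
  have h1 := le_antisymm ((h.lintegral_comp_le hgm).trans h0.le) bot_le
  rw [lintegral_eq_zero_iff (by fun_prop)] at h1
  filter_upwards [h1, ae_sphMeasure_mem n] with x hx hxS hzero
  have hpos := h.factor_pos x hxS
  have hxA : φ x ∈ A := hzero
  simp [hxA] at hx
  exact (pow_pos hpos n).not_ge hx

end IsConformalOnSphere

lemma sphMeasure_pos_of_isOpen {n : ℕ} {U : Set (Eu n)} (hU : IsOpen U) {x : Eu n}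
    (hx : x ∈ sphSet n) (hxU : x ∈ U) : 0 < sphMeasure n U := by
  rw [sphMeasure, Measure.map_apply measurable_subtype_coe hU.measurableSet]
  exact (hU.preimage continuous_subtype_val).measure_pos _ ⟨⟨x, hx⟩, hxU⟩

lemma exists_ne_zero_inner_eq_zero_of_one_le {n : ℕ} (hn : 1 ≤ n) (s : Eu n) :
    ∃ q : Eu n, q ≠ 0 ∧ (⟪q, s⟫ : ℝ) = 0 := by
  by_contra! hcon
  have hbot : (ℝ ∙ s)ᗮ = ⊥ := by
    rw [Submodule.eq_bot_iff]
    intro q hq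
    by_contra hq0
    exact hcon q hq0 (by
      rw [real_inner_comm]
      exact Submodule.mem_orthogonal_singleton_iff_inner_right.1 hq)
  have htop := (Submodule.orthogonal_eq_bot_iff).1 hbot
  have h1 := finrank_span_le_card (R := ℝ) ({s} : Set (Eu n))
  rw [htop, finrank_top, finrank_euclideanSpace_fin, Set.toFinset_singleton,
    Finset.card_singleton] at h1
  omega

lemma gradS_congr {n : ℕ} {f g : Eu n → ℝ} {x : Eu n} (h : f =ᶠ[𝓝 x] g) :
    gradS f x = gradS g x := by
  rw [gradS, gradS, gradient, gradient, h.fderiv_eq]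

lemma ENNReal.ofReal_pow_rpow_div {a : ℝ} (ha : 0 ≤ a) {m : ℕ} (hm : m ≠ 0) (k : ℕ) :
    ENNReal.ofReal (a ^ m) ^ ((k : ℝ) / m) = ENNReal.ofReal (a ^ k) := by
  rw [ENNReal.ofReal_rpow_of_nonneg (by positivity) (by positivity), ← Real.rpow_natCast_mul ha,
    mul_div_cancel₀ _ (by positivity), Real.rpow_natCast]

lemma lintegral_norm_gradS_Xfun_lt_top {n : ℕ} (s : Eu n) :
    ∫⁻ x, ENNReal.ofReal (‖s - (⟪s, x⟫ : ℝ) • x‖ ^ n) ∂(sphMeasure n) < ∞ := by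
  calc ∫⁻ x, ENNReal.ofReal (‖s - (⟪s, x⟫ : ℝ) • x‖ ^ n) ∂(sphMeasure n)
      ≤ ∫⁻ _, ENNReal.ofReal ((2 * ‖s‖) ^ n) ∂(sphMeasure n) := by
        refine lintegral_mono_ae ?_
        filter_upwards [ae_sphMeasure_mem n] with x hx
        have hx1 : ‖x‖ = 1 := by simpa [sphSet] using hx
        have h2 := abs_real_inner_le_norm s x
        gcongr
        refine (norm_sub_le _ _).trans ?_
        rw [norm_smul, hx1, Real.norm_eq_abs]
        rw [hx1] at h2
        linarith
    _ < ∞ := by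
        rw [lintegral_const]
        exact ENNReal.mul_lt_top ENNReal.ofReal_lt_top (measure_lt_top _ _)

/-- A function glued from the pullbacks of a coordinate under two conformal maps, where the first
pullback is not used on a set of positive measure, has conformal energy less than twice
that of the coordinate. -/
lemma lintegral_ite_lt {n : ℕ} (hn : 1 ≤ n) {φ ψ : Eu n → Eu n} {c d : Eu n → ℝ}
    (hφ : IsConformalOnSphere φ c) (hψ : IsConformalOnSphere ψ d) {s : Eu n} (hs : s ≠ 0)
    {A : Set (Eu n)} (hA : MeasurableSet A) (hAc : 0 < sphMeasure n Aᶜ) :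
    ∫⁻ x, ENNReal.ofReal ((if x ∈ A then c x * ‖s - (⟪s, φ x⟫ : ℝ) • φ x‖
        else d x * ‖s - (⟪s, ψ x⟫ : ℝ) • ψ x‖) ^ n) ∂(sphMeasure n) <
      2 * ∫⁻ x, ENNReal.ofReal (‖s - (⟪s, x⟫ : ℝ) • x‖ ^ n) ∂(sphMeasure n) := by
  set G : Eu n → ℝ≥0∞ := fun y => ENNReal.ofReal (‖s - (⟪s, y⟫ : ℝ) • y‖ ^ n) with hG
  have hGm : Measurable G := by fun_prop
  set I := ∫⁻ x, G x ∂(sphMeasure n) with hI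
  have hItop : I < ∞ := lintegral_norm_gradS_Xfun_lt_top s
  have hφm := hφ.measurable
  have hcm := hφ.measurable_factor
  have key : ∀ {φ : Eu n → Eu n} {c : Eu n → ℝ}, IsConformalOnSphere φ c → ∀ x ∈ sphSet n,
      ENNReal.ofReal ((c x * ‖s - (⟪s, φ x⟫ : ℝ) • φ x‖) ^ n) =
        ENNReal.ofReal (c x ^ n) * G (φ x) := fun h x hx => by
    rw [mul_pow, ENNReal.ofReal_mul (pow_nonneg (h.factor_pos x hx).le _)]
  have hsplit : ∫⁻ x, ENNReal.ofReal ((if x ∈ A then c x * ‖s - (⟪s, φ x⟫ : ℝ) • φ x‖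
        else d x * ‖s - (⟪s, ψ x⟫ : ℝ) • ψ x‖) ^ n) ∂(sphMeasure n) =
      ∫⁻ x in A, ENNReal.ofReal (c x ^ n) * G (φ x) ∂(sphMeasure n) +
        ∫⁻ x in Aᶜ, ENNReal.ofReal (d x ^ n) * G (ψ x) ∂(sphMeasure n) := by
    rw [← lintegral_add_compl _ hA]
    congr 1
    · refine setLIntegral_congr_fun_ae hA ?_
      filter_upwards [ae_sphMeasure_mem n] with x hx hxA
      rw [if_pos hxA, key hφ x hx]
    · refine setLIntegral_congr_fun_ae hA.compl ?_
      filter_upwards [ae_sphMeasure_mem n] with x hx hxA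
      rw [if_neg hxA, key hψ x hx]
  have hpos : 0 < ∫⁻ x in Aᶜ, ENNReal.ofReal (c x ^ n) * G (φ x) ∂(sphMeasure n) := by
    obtain ⟨q, hq0, hqs⟩ := exists_ne_zero_inner_eq_zero_of_one_le hn s
    rw [pos_iff_ne_zero, Ne, lintegral_eq_zero_iff (by fun_prop)]
    intro hzero
    refine hAc.ne' ?_
    rw [← Measure.restrict_eq_zero, ← ae_eq_bot]
    refine Filter.eventually_false_iff_eq_bot.1 ?_
    filter_upwards [hzero, ae_restrict_of_ae (hφ.ae_inner_ne_zero hq0),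
      ae_restrict_of_ae (ae_sphMeasure_mem n)] with x hx hxq hxS
    have hc := hφ.factor_pos x hxS
    have hN : s - (⟪s, φ x⟫ : ℝ) • φ x ≠ 0 := by
      intro h0
      have hs' : s = (⟪s, φ x⟫ : ℝ) • φ x := sub_eq_zero.1 h0
      have hne : (⟪s, φ x⟫ : ℝ) ≠ 0 := fun h => hs (by rw [hs', h, zero_smul])
      rw [hs', inner_smul_right] at hqs
      exact (mul_ne_zero hne hxq) hqs
    have : 0 < ENNReal.ofReal (c x ^ n) * G (φ x) :=
      ENNReal.mul_pos (ENNReal.ofReal_pos.2 (pow_pos hc n)).ne'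
        (ENNReal.ofReal_pos.2 (pow_pos (norm_pos_iff.2 hN) n)).ne'
    exact this.ne' hx
  have h1 := hφ.lintegral_comp_le hGm
  rw [← lintegral_add_compl _ hA] at h1
  have h2 := (setLIntegral_le_lintegral Aᶜ _).trans (hψ.lintegral_comp_le hGm)
  have hfin := (le_self_add.trans h1).trans_lt hItop
  rw [hsplit, two_mul]
  exact ENNReal.add_lt_add_of_lt_of_le (h2.trans_lt hItop).ne
    ((ENNReal.lt_add_right hfin.ne hpos.ne').trans_le h1) h2

/-- For every cap `a` (with renormalization point `ξ`) and every `s ∈ S^n`,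
the test function `u_a^s` satisfies
`∫_{S^n} |∇_g u_a^s|²_g dv_g < (2 ∫_{S^n} |∇_{g₀} X_s|^n dv_{g₀})^{2/n}`. -/
theorem testFun_energy_bound (n : ℕ) (hn : 2 ≤ n)
    (w : Eu n → ℝ) (hw : IsConformalFactor n w) (hvol : confMeasure n w Set.univ = 1)
    (r : ℝ) (hr : r ∈ Set.Ioo (-1 : ℝ) 1) (p : Eu n) (hp : p ∈ sphSet n)
    (s : Eu n) (hs : s ∈ sphSet n)
    (ξ : Eu n) (hξ : ‖ξ‖ < 1) (hren : Renormalizes ξ (capMeasure n w r p)) :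
    dirichlet n w (testFun n ξ r p s) <
      (2 * ∫ x, ‖gradS (Xfun s) x‖ ^ n ∂(sphMeasure n)) ^ ((2 : ℝ) / n) := by
  have hp1 : ‖p‖ = 1 := by simpa [sphSet] using hp
  have hs0 : s ≠ 0 := by
    rintro rfl
    simp [sphSet] at hs
  have hn0 : n ≠ 0 := by omega
  have hrp : ‖r • p‖ < 1 := by
    rw [norm_smul, hp1, mul_one, Real.norm_eq_abs, abs_lt]
    exact hr
  have hrp' : ‖-(r • p)‖ < 1 := by rwa [norm_neg]
  have hφ := isConformalOnSphere_dMap hξ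
  have hη := isConformalOnSphere_dMap hrp'
  obtain ⟨d, hψ⟩ : ∃ d, IsConformalOnSphere (fun x => dMap ξ (tauMap r p x)) d :=
    ⟨_, hφ.comp ((isConformalOnSphere_dMap hrp).comp ((isConformalOnSphere_Refl hp1).comp hη))⟩
  set A : Set (Eu n) := {x | 0 < (⟪p, dMap (-(r • p)) x⟫ : ℝ)} with hA
  have hηm := hη.measurable
  have hφm := hφ.measurable
  have hcm := hφ.measurable_factor
  have hψm := hψ.measurable
  have hdm := hψ.measurable_factor
  have hAm : MeasurableSet A := measurableSet_lt measurable_const (by fun_prop)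
  have hAc : 0 < sphMeasure n Aᶜ := by
    have hpn : ‖-p‖ = 1 := by rw [norm_neg, hp1]
    have hx₀ : dMap (r • p) (-p) ∈ sphSet n :=
      (isConformalOnSphere_dMap hrp).mapsTo (by simpa [sphSet] using hp1)
    have hcont : ContinuousAt (fun y => (⟪p, dMap (-(r • p)) y⟫ : ℝ)) (dMap (r • p) (-p)) :=
      continuousAt_const.inner (hη.continuousAt hx₀)
    have hneg : (⟪p, dMap (-(r • p)) (dMap (r • p) (-p))⟫ : ℝ) < 0 := by
      rw [dMap_neg_dMap hrp hpn, inner_neg_right, real_inner_self_eq_norm_sq, hp1]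
      norm_num
    obtain ⟨U, hUA, hU, hxU⟩ := _root_.mem_nhds_iff.1 (hcont.eventually_lt_const hneg)
    have hUA' : U ⊆ Aᶜ := fun x hx hxA => by
      have h1 : (⟪p, dMap (-(r • p)) x⟫ : ℝ) < 0 := hUA hx
      have h2 : 0 < (⟪p, dMap (-(r • p)) x⟫ : ℝ) := hxA
      exact h1.not_gt h2
    exact (sphMeasure_pos_of_isOpen hU hx₀ hxU).trans_le (measure_mono hUA')
  set F : Eu n → ℝ := fun x => if x ∈ A then dFactor ξ x * ‖s - (⟪s, dMap ξ x⟫ : ℝ) • dMap ξ x‖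
    else d x * ‖s - (⟪s, dMap ξ (tauMap r p x)⟫ : ℝ) • dMap ξ (tauMap r p x)‖ with hF
  have hFm : Measurable F := Measurable.ite hAm (by fun_prop) (by fun_prop)
  have hgrad : ∀ᵐ x ∂(sphMeasure n), ‖gradS (testFun n ξ r p s) x‖ = F x := by
    have hp0 : p ≠ 0 := norm_ne_zero_iff.1 (by rw [hp1]; exact one_ne_zero)
    filter_upwards [hη.ae_inner_ne_zero hp0, ae_sphMeasure_mem n] with x hx hxS
    have hcont : ContinuousAt (fun y => (⟪p, dMap (-(r • p)) y⟫ : ℝ)) x :=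
      continuousAt_const.inner (hη.continuousAt hxS)
    rcases hx.lt_or_gt with hneg | hpos
    · have hev : testFun n ξ r p s =ᶠ[𝓝 x] fun y => Xfun s (dMap ξ (tauMap r p y)) := by
        filter_upwards [hcont.eventually_lt_const hneg] with y hy
        rw [testFun, if_neg hy.not_gt]
      rw [gradS_congr hev, hψ.norm_gradS_comp s hxS, hF]
      exact (if_neg hneg.not_gt).symm
    · have hev : testFun n ξ r p s =ᶠ[𝓝 x] fun y => Xfun s (dMap ξ y) := by
        filter_upwards [hcont.eventually_const_lt hpos] with y hy
        rw [testFun, if_pos hy]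
      rw [gradS_congr hev, hφ.norm_gradS_comp s hxS, hF]
      exact (if_pos hpos).symm
  set I : ℝ≥0∞ := ∫⁻ x, ENNReal.ofReal (‖s - (⟪s, x⟫ : ℝ) • x‖ ^ n) ∂(sphMeasure n) with hI
  have hItop : I < ∞ := lintegral_norm_gradS_Xfun_lt_top s
  have hIint : ∫ x, ‖gradS (Xfun s) x‖ ^ n ∂(sphMeasure n) = I.toReal := by
    simp only [gradS_Xfun]
    exact integral_eq_lintegral_of_nonneg_ae (Filter.Eventually.of_forall fun x => by positivity)
      (by fun_prop)
  set J : ℝ≥0∞ := ∫⁻ x, ENNReal.ofReal (F x ^ n) ∂(sphMeasure n) with hJ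
  have hJI : J < 2 * I := lintegral_ite_lt (by omega) hφ hψ hs0 hAm hAc
  have hwm : Measurable w := hw.1.continuous.measurable
  have hw1 : ∫⁻ x, ENNReal.ofReal (w x ^ n) ∂(sphMeasure n) = 1 := by
    rw [← hvol, confMeasure, withDensity_apply _ MeasurableSet.univ, Measure.restrict_univ]
  have hHolder : ∫⁻ x, ENNReal.ofReal ‖w x ^ (n - 2) * ‖gradS (testFun n ξ r p s) x‖ ^ 2‖
      ∂(sphMeasure n) ≤ J ^ ((2 : ℝ) / n) := by
    have hpq : ((n - 2 : ℕ) : ℝ) / n + ((2 : ℕ) : ℝ) / n = 1 := by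
      rw [← add_div, ← Nat.cast_add, Nat.sub_add_cancel hn, div_self (by positivity)]
    calc _ = ∫⁻ x, ENNReal.ofReal (w x ^ n) ^ (((n - 2 : ℕ) : ℝ) / n) *
          ENNReal.ofReal (F x ^ n) ^ (((2 : ℕ) : ℝ) / n) ∂(sphMeasure n) := by
          refine lintegral_congr_ae ?_
          filter_upwards [hgrad, ae_sphMeasure_mem n] with x hx hxS
          have hwx := hw.2 x hxS
          have hFx : 0 ≤ F x := hx ▸ norm_nonneg _
          rw [ENNReal.ofReal_pow_rpow_div hwx.le hn0, ENNReal.ofReal_pow_rpow_div hFx hn0, hx,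
            ← ENNReal.ofReal_mul (by positivity), Real.norm_of_nonneg (by positivity)]
      _ ≤ (∫⁻ x, ENNReal.ofReal (w x ^ n) ∂(sphMeasure n)) ^ (((n - 2 : ℕ) : ℝ) / n) *
          J ^ (((2 : ℕ) : ℝ) / n) :=
          ENNReal.lintegral_mul_norm_pow_le (by fun_prop) (by fun_prop) (by positivity)
            (by positivity) hpq
      _ = J ^ ((2 : ℝ) / n) := by rw [hw1, ENNReal.one_rpow, one_mul, Nat.cast_ofNat]
  have h2I : 2 * I ≠ ∞ := ENNReal.mul_ne_top (by simp) hItop.ne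
  have hexp : (0 : ℝ) < 2 / n := by positivity
  calc dirichlet n w (testFun n ξ r p s)
      ≤ (∫⁻ x, ENNReal.ofReal ‖w x ^ (n - 2) * ‖gradS (testFun n ξ r p s) x‖ ^ 2‖
        ∂(sphMeasure n)).toReal := by
        rw [dirichlet]
        exact (Real.le_norm_self _).trans (norm_integral_le_lintegral_norm _)
    _ ≤ (J ^ ((2 : ℝ) / n)).toReal :=
        ENNReal.toReal_mono (ENNReal.rpow_ne_top_of_nonneg hexp.le hJI.ne_top) hHolder
    _ < ((2 * I) ^ ((2 : ℝ) / n)).toReal :=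
        (ENNReal.toReal_lt_toReal (ENNReal.rpow_ne_top_of_nonneg hexp.le hJI.ne_top)
          (ENNReal.rpow_ne_top_of_nonneg hexp.le h2I)).2 (ENNReal.rpow_lt_rpow hJI hexp)
    _ = _ := by rw [← ENNReal.toReal_rpow, ENNReal.toReal_mul, hIint]; rfl

end
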